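/- Let H be a complex Hilbert space and let D and P be bounded self-adjoint operators on H, with P a compact operator. Suppose there is a real κ₀ > 0 such that ⟨(D² + P)x, x⟩ ≥ κ₀ ‖x‖² for all x ∈ H. Then a := D² + P is self-adjoint, positive and invertible in the C*-algebra of bounded operators on H, and the operator F := a^{-1/2} ∘ D satisfies: F - F* is a compact operator and F ∘ F - id is a compact operator. -/

import Mathlib

open scoped InnerProductSpace

section helpers
variable {H : Type*} [NormedAddCommGroup H] [InnerProductSpace ℂ H] [CompleteSpace H]

theorem cpt_mul_left (A : H →L[ℂ] H) {K : H →L[ℂ] H} (hK : IsCompactOperator ⇑K) :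
    IsCompactOperator ⇑(A * K) := hK.clm_comp A

theorem cpt_mul_right {K : H →L[ℂ] H} (hK : IsCompactOperator ⇑K) (A : H →L[ℂ] H) :
    IsCompactOperator ⇑(K * A) := hK.comp_clm A

theorem cpt_add {K L : H →L[ℂ] H} (hK : IsCompactOperator ⇑K) (hL : IsCompactOperator ⇑L) :
    IsCompactOperator ⇑(K + L) := hK.add hL

theorem cpt_sub {K L : H →L[ℂ] H} (hK : IsCompactOperator ⇑K) (hL : IsCompactOperator ⇑L) :
    IsCompactOperator ⇑(K - L) := hK.sub hL

theorem comm_mul (D x y : H →L[ℂ] H) (hx : IsCompactOperator ⇑(x * D - D * x))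
    (hy : IsCompactOperator ⇑(y * D - D * y)) :
    IsCompactOperator ⇑(x * y * D - D * (x * y)) := by
  have h : x * y * D - D * (x * y) = x * (y * D - D * y) + (x * D - D * x) * y := by
    noncomm_ring
  rw [h]
  exact cpt_add (cpt_mul_left _ hy) (cpt_mul_right hx _)

theorem comm_add (D x y : H →L[ℂ] H) (hx : IsCompactOperator ⇑(x * D - D * x))
    (hy : IsCompactOperator ⇑(y * D - D * y)) :
    IsCompactOperator ⇑((x + y) * D - D * (x + y)) := by
  have h : (x + y) * D - D * (x + y) = (x * D - D * x) + (y * D - D * y) := by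
    noncomm_ring
  rw [h]
  exact cpt_add hx hy

theorem comm_alg (D : H →L[ℂ] H) (r : ℝ) :
    IsCompactOperator ⇑(algebraMap ℝ (H →L[ℂ] H) r * D - D * algebraMap ℝ (H →L[ℂ] H) r) := by
  rw [Algebra.commutes, sub_self]
  exact isCompactOperator_zero

/-- Operators commuting with `D` modulo compacts, together with their adjoints. -/
def commAlg (D : H →L[ℂ] H) : StarSubalgebra ℝ (H →L[ℂ] H) where
  carrier := {x | IsCompactOperator ⇑(x * D - D * x) ∧
    IsCompactOperator ⇑(star x * D - D * star x)}
  mul_mem' := by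
    rintro x y ⟨hx, hx'⟩ ⟨hy, hy'⟩
    refine ⟨comm_mul D x y hx hy, ?_⟩
    rw [star_mul]
    exact comm_mul D _ _ hy' hx'
  add_mem' := by
    rintro x y ⟨hx, hx'⟩ ⟨hy, hy'⟩
    refine ⟨comm_add D x y hx hy, ?_⟩
    rw [star_add]
    exact comm_add D _ _ hx' hy'
  algebraMap_mem' := by
    intro r
    refine ⟨comm_alg D r, ?_⟩
    rw [← algebraMap_star_comm]
    exact comm_alg D _
  star_mem' := by
    rintro x ⟨hx, hx'⟩
    exact ⟨hx', by rw [star_star]; exact hx⟩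

theorem commAlg_closed (D : H →L[ℂ] H) : IsClosed (commAlg D : Set (H →L[ℂ] H)) := by
  have hc : IsClosed {f : H →L[ℂ] H | IsCompactOperator ⇑f} :=
    isClosed_setOfPred_isCompactOperator
  have h1 : Continuous fun x : H →L[ℂ] H => x * D - D * x := by fun_prop
  have h2 : Continuous fun x : H →L[ℂ] H => star x * D - D * star x := h1.comp continuous_star
  exact (hc.preimage h1).inter (hc.preimage h2)

theorem sqrt_comm (D a : H →L[ℂ] H) (ha : 0 ≤ a) (h : IsCompactOperator ⇑(a * D - D * a)) :
    IsCompactOperator ⇑(CFC.sqrt a * D - D * CFC.sqrt a) := by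
  have hm : a ∈ commAlg D := ⟨h, by rw [ha.isSelfAdjoint.star_eq]; exact h⟩
  have h1 := StarAlgebra.elemental.le_of_mem (commAlg_closed D) hm
  have h2 : CFC.sqrt a ∈ StarAlgebra.elemental ℝ a := by
    rw [CFC.sqrt_eq_cfc]
    exact (range_cfc_nnreal_subset a ha ⟨_, rfl⟩).1
  exact (h1 h2).1

end helpers

/-- Let `H` be a complex Hilbert space, `D`, `P` bounded self-adjoint
operators on `H` with `P` compact, and suppose `⟨(D² + P)x, x⟩ ≥ κ₀‖x‖²` for all `x`,
where `κ₀ > 0` is real. Then `a := D² + P` is self-adjoint, positive and invertible in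
the C*-algebra of bounded operators on `H`, and `F := a^{-1/2} ∘ D` satisfies:
`F - F*` is compact and `F ∘ F - id` is compact. -/
theorem stmt10 {H : Type*} [NormedAddCommGroup H] [InnerProductSpace ℂ H] [CompleteSpace H]
    (D P : H →L[ℂ] H) (hD : IsSelfAdjoint D) (hP : IsSelfAdjoint P)
    (hPcompact : IsCompactOperator ⇑P) (κ₀ : ℝ) (hκ : 0 < κ₀)
    (hcoercive : ∀ x : H, κ₀ * ‖x‖ ^ 2 ≤ (⟪(D ^ 2 + P) x, x⟫_ℂ).re) :
    IsSelfAdjoint (D ^ 2 + P) ∧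
      0 ≤ D ^ 2 + P ∧
      IsUnit (D ^ 2 + P) ∧
      IsCompactOperator
        ⇑(Ring.inverse (CFC.sqrt (D ^ 2 + P)) * D -
          star (Ring.inverse (CFC.sqrt (D ^ 2 + P)) * D)) ∧
      IsCompactOperator
        ⇑(Ring.inverse (CFC.sqrt (D ^ 2 + P)) * D *
          (Ring.inverse (CFC.sqrt (D ^ 2 + P)) * D) - 1) := by
  have hsa : IsSelfAdjoint (D ^ 2 + P) := (hD.pow 2).add hP
  have hpos : 0 ≤ D ^ 2 + P := by
    rw [ContinuousLinearMap.nonneg_iff_isPositive, ContinuousLinearMap.isPositive_def]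
    refine ⟨hsa.isSymmetric, fun x => ?_⟩
    exact le_trans (by positivity) (hcoercive x)
  have hu : IsUnit (D ^ 2 + P) := by
    refine ContinuousLinearMap.isUnit_of_forall_le_norm_inner_map _
      (c := ⟨κ₀, hκ.le⟩) hκ fun x => ?_
    have h1 := (hcoercive x).trans (Complex.re_le_norm _)
    rw [mul_comm]
    exact h1
  refine ⟨hsa, hpos, hu, ?_⟩
  have hcomm : IsCompactOperator ⇑((D ^ 2 + P) * D - D * (D ^ 2 + P)) := by
    have h : (D ^ 2 + P) * D - D * (D ^ 2 + P) = P * D - D * P := by noncomm_ring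
    rw [h]
    exact cpt_sub (cpt_mul_right hPcompact _) (cpt_mul_left _ hPcompact)
  have hs := sqrt_comm D _ hpos hcomm
  have hss : CFC.sqrt (D ^ 2 + P) * CFC.sqrt (D ^ 2 + P) = D ^ 2 + P :=
    CFC.sqrt_mul_sqrt_self _ hpos
  have hssa : IsSelfAdjoint (CFC.sqrt (D ^ 2 + P)) := (CFC.sqrt_nonneg _).isSelfAdjoint
  generalize CFC.sqrt (D ^ 2 + P) = s at *
  have hsu : IsUnit s := by
    rw [← hss] at hu
    exact ((Commute.refl s).isUnit_mul_iff.1 hu).1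
  obtain ⟨b, hb⟩ : ∃ b, b = Ring.inverse s := ⟨_, rfl⟩
  have hbs : b * s = 1 := by rw [hb]; exact Ring.inverse_mul_cancel _ hsu
  have hsb : s * b = 1 := by rw [hb]; exact Ring.mul_inverse_cancel _ hsu
  rw [← hb]
  have hbsa : star b = b := by
    have h1 : star b * s = 1 := by
      have := congrArg star hsb
      rwa [star_mul, hssa.star_eq, star_one] at this
    calc star b = star b * (s * b) := by rw [hsb, mul_one]
      _ = b := by rw [← mul_assoc, h1, one_mul]
  have hK : IsCompactOperator ⇑(b * D - D * b) := by
    have h : b * D - D * b = -(1 : H →L[ℂ] H) * (b * (s * D - D * s) * b) := by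
      have : b * (s * D - D * s) * b = (b * s) * D * b - b * D * (s * b) := by noncomm_ring
      rw [this, hbs, hsb]
      noncomm_ring
    rw [h]
    exact cpt_mul_left _ (cpt_mul_right (cpt_mul_left _ hs) _)
  constructor
  · rw [star_mul, hbsa, hD.star_eq]
    exact hK
  · have hD2 : D * D = s * s - P := by rw [hss]; noncomm_ring
    have h : b * D * (b * D) - 1 = b * (-(b * D - D * b)) * D - b * b * P := by
      have h1 : b * (-(b * D - D * b)) * D = b * D * (b * D) - b * b * (D * D) := by noncomm_ring
      have h2 : b * b * (s * s - P) = b * (b * s) * s - b * b * P := by noncomm_ring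
      rw [h1, hD2, h2, hbs, mul_one, hbs]
      noncomm_ring
    rw [h]
    exact cpt_sub (cpt_mul_right (cpt_mul_left _ hK.neg) _) (cpt_mul_left _ hPcompact)
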